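/- Let u : ℝ³ ∖ {0} → ℝ be smooth and homogeneous of degree 0. Then ∫_{S²} [ 2 tr( H_u(x)² ) − (Δu(x))² ] dS = ∫_{S²} u(x) · Δ(Δu)(x) dS, where Δ is the ambient Euclidean Laplacian. (This realizes the identity ∫_{S²} [2 |∇²u|² − (Δ_{S²}u)²] = ∫_{S²} u Δ_{S²}(Δ_{S²}+2)u on the round sphere, since on degree-0 homogeneous functions Δ_{S²}(Δ_{S²}+2) is realized by the ambient bi-Laplacian Δ².) -/

import Mathlib

open MeasureTheory Matrix

noncomputable section

/-- Euclidean 3-space. -/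
abbrev E3 := EuclideanSpace ℝ (Fin 3)

/-- The Euclidean inner product on coordinate vectors. -/
def dot3 (a b : Fin 3 → ℝ) : ℝ := ∑ i, a i * b i

/-- The cross product in ℝ³. -/
def cross3 (a b : Fin 3 → ℝ) : Fin 3 → ℝ :=
  ![a 1 * b 2 - a 2 * b 1, a 2 * b 0 - a 0 * b 2, a 0 * b 1 - a 1 * b 0]

/-- Standard basis vectors of E3. -/
def e3 (i : Fin 3) : E3 := EuclideanSpace.single i 1

/-- The ambient gradient of `u : ℝ³ → ℝ` (as a coordinate vector). -/
def grad3 (u : E3 → ℝ) (x : E3) : Fin 3 → ℝ := fun i => fderiv ℝ u x (e3 i)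

/-- The ambient Hessian matrix of `u : ℝ³ → ℝ`. -/
def hess3 (u : E3 → ℝ) (x : E3) : Matrix (Fin 3) (Fin 3) ℝ :=
  Matrix.of fun i j => iteratedFDeriv ℝ 2 u x ![e3 i, e3 j]

/-- The ambient Euclidean Laplacian Δu = Σᵢ ∂²u/∂xᵢ². -/
def lap3 (u : E3 → ℝ) : E3 → ℝ := fun x => ∑ i, hess3 u x i i

/-- The orthogonal projection P(x) = I - x xᵀ onto the tangent plane of S² at x. -/
def proj3 (x : E3) : Matrix (Fin 3) (Fin 3) ℝ := 1 - Matrix.of fun i j => x i * x j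

/-- The projected ambient Hessian H_u(x) = P(x) (D²u)(x) P(x), realizing the intrinsic
Hessian on S² of the restriction of a degree-0 homogeneous function. -/
def hessS (u : E3 → ℝ) (x : E3) : Matrix (Fin 3) (Fin 3) ℝ := proj3 x * hess3 u x * proj3 x

/-- The matrix of the linear map `w ↦ x × w` on ℝ³. -/
def crossMat (x : E3) : Matrix (Fin 3) (Fin 3) ℝ :=
  !![0, -x 2, x 1; x 2, 0, -x 0; -x 1, x 0, 0]

/-- `u` is (positively) homogeneous of degree 0 away from the origin. -/
def Homog0 (u : E3 → ℝ) : Prop := ∀ c : ℝ, 0 < c → ∀ x : E3, x ≠ 0 → u (c • x) = u x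

/-- The unit sphere of `E3` has finite two-dimensional Hausdorff measure. -/
theorem hausdorffMeasure_unitSphere_lt_top : μH[2] (Metric.sphere (0 : E3) 1) < ⊤ := by
  let Φ : (Fin 2 → ℝ) → E3 := fun p =>
    !₂[Real.sin (p 0) * Real.cos (p 1), Real.sin (p 0) * Real.sin (p 1), Real.cos (p 0)]
  let K : Set (Fin 2 → ℝ) := Set.Icc (fun _ => -Real.pi) (fun _ => Real.pi)
  have hK : IsCompact K := isCompact_Icc
  have hΦ : ContDiff ℝ 1 Φ := by
    rw [contDiff_piLp]
    intro i
    fin_cases i <;> simp [Φ] <;> fun_prop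
  obtain ⟨C, hC⟩ := hΦ.locallyLipschitz.locallyLipschitzOn.exists_lipschitzOnWith_of_compact hK
  have hsub : Metric.sphere (0 : E3) 1 ⊆ Φ '' K := by
    intro x hx
    have hx1 : x 0 ^ 2 + x 1 ^ 2 + x 2 ^ 2 = 1 := by
      have h := EuclideanSpace.real_norm_sq_eq x
      rw [mem_sphere_zero_iff_norm.mp hx, Fin.sum_univ_three] at h
      linarith
    have h2 : -1 ≤ x 2 ∧ x 2 ≤ 1 := by constructor <;> nlinarith [sq_nonneg (x 0), sq_nonneg (x 1)]
    let z : ℂ := ⟨x 0, x 1⟩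
    have hz : ‖z‖ = Real.sin (Real.arccos (x 2)) := by
      rw [Real.sin_arccos, Complex.norm_def, Complex.normSq_apply]
      congr 1
      simp only [z]
      linarith
    refine ⟨![Real.arccos (x 2), z.arg], ⟨?_, ?_⟩, ?_⟩
    · intro i
      fin_cases i
      · simpa using (neg_nonpos.mpr Real.pi_pos.le).trans (Real.arccos_nonneg (x 2))
      · simpa using (Complex.neg_pi_lt_arg z).le
    · intro i
      fin_cases i
      · simpa using Real.arccos_le_pi (x 2)
      · simpa using Complex.arg_le_pi z
    · ext i
      fin_cases i
      · simp [Φ, ← hz, Complex.norm_mul_cos_arg, z]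
      · simp [Φ, ← hz, Complex.norm_mul_sin_arg, z]
      · simp [Φ, Real.cos_arccos h2.1 h2.2]
  have h2 : (2 : ℝ) = (Fintype.card (Fin 2) : ℝ) := by simp
  refine (measure_mono hsub).trans_lt
    ((hC.hausdorffMeasure_image_le zero_le_two).trans_lt (ENNReal.mul_lt_top ?_ ?_))
  · exact ENNReal.rpow_lt_top_of_nonneg zero_le_two ENNReal.coe_ne_top
  · rw [h2, hausdorffMeasure_pi_real]
    exact hK.measure_lt_top

/-- Surface measure on the unit sphere, as a measure on `E3`. -/
abbrev sphereMeasure : Measure E3 := (μH[2]).restrict (Metric.sphere (0 : E3) 1)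

instance : IsFiniteMeasure sphereMeasure :=
  ⟨by simpa using hausdorffMeasure_unitSphere_lt_top⟩

theorem ae_mem_sphere : ∀ᵐ x ∂sphereMeasure, x ∈ Metric.sphere (0 : E3) 1 :=
  ae_restrict_mem Metric.isClosed_sphere.measurableSet

theorem ContinuousOn.exists_norm_le_sphere {f : E3 → ℝ} (hf : ContinuousOn f {(0 : E3)}ᶜ) :
    ∃ M, ∀ x ∈ Metric.sphere (0 : E3) 1, ‖f x‖ ≤ M :=
  (isCompact_sphere (0 : E3) 1).exists_bound_of_continuousOn
    (hf.mono fun _ hx => Metric.ne_of_mem_sphere hx one_ne_zero)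

theorem ContinuousOn.integrable_sphereMeasure {f : E3 → ℝ} (hf : ContinuousOn f {(0 : E3)}ᶜ) :
    Integrable f sphereMeasure := by
  obtain ⟨M, hM⟩ := hf.exists_norm_le_sphere
  refine Integrable.of_bound (C := M) ?_ (ae_mem_sphere.mono hM)
  exact (hf.mono fun _ hx => Metric.ne_of_mem_sphere hx one_ne_zero).aestronglyMeasurable
    Metric.isClosed_sphere.measurableSet

theorem LinearIsometryEquiv.measurePreserving_sphereMeasure (R : E3 ≃ₗᵢ[ℝ] E3) :
    MeasurePreserving R sphereMeasure sphereMeasure := by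
  have h := (R.toIsometryEquiv.measurePreserving_hausdorffMeasure 2).restrict_preimage
    (s := Metric.sphere (0 : E3) 1) Metric.isClosed_sphere.measurableSet
  have hpre : R.toIsometryEquiv ⁻¹' Metric.sphere (0 : E3) 1 = Metric.sphere (0 : E3) 1 := by
    ext x
    simp
  rwa [hpre] at h

/-- The derivative along an infinitesimal rotation integrates to zero over the unit sphere. -/
theorem integral_fderiv_skewAdjoint {f : E3 → ℝ} (hf : ContDiffOn ℝ (⊤ : ℕ∞) f {(0 : E3)}ᶜ)
    {A : E3 →L[ℝ] E3} (hA : A ∈ skewAdjoint (E3 →L[ℝ] E3)) :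
    ∫ x, fderiv ℝ f x (A x) ∂sphereMeasure = 0 := by
  let _ : NormedAlgebra ℚ (E3 →L[ℝ] E3) := NormedAlgebra.restrictScalars ℚ ℝ _
  let R : ℝ → (E3 ≃ₗᵢ[ℝ] E3) := fun t => Unitary.linearIsometryEquiv
    ⟨NormedSpace.exp (t • A), NormedSpace.exp_mem_unitary_of_mem_skewAdjoint
      (skewAdjoint.smul_mem t hA)⟩
  have hR : ∀ t x, R t x = NormedSpace.exp (t • A) x := fun _ _ => rfl
  have hRmem : ∀ t, ∀ x ∈ Metric.sphere (0 : E3) 1, R t x ∈ Metric.sphere (0 : E3) 1 := by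
    intro t x hx
    simpa using hx
  have hderivR : ∀ t x, HasDerivAt (fun s => R s x) (A (R t x)) t := by
    intro t x
    have h := (ContinuousLinearMap.apply ℝ E3 x).hasFDerivAt.comp_hasDerivAt t
      (hasDerivAt_exp_smul_const' (𝕂 := ℝ) A t)
    exact h
  have hcont : ContinuousOn (fun x => fderiv ℝ f x (A x)) {(0 : E3)}ᶜ :=
    (hf.continuousOn_fderiv_of_isOpen isOpen_compl_singleton (by simp)).clm_apply
      A.continuous.continuousOn
  obtain ⟨M, hM⟩ := hcont.exists_norm_le_sphere
  have hR0 : ∀ x, R 0 x = x := by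
    intro x
    have h : NormedSpace.exp ((0 : ℝ) • A) = 1 :=
      (congrArg NormedSpace.exp (zero_smul ℝ A)).trans NormedSpace.exp_zero
    exact DFunLike.congr_fun h x
  have key := hasDerivAt_integral_of_dominated_loc_of_deriv_le (μ := sphereMeasure)
    (F := fun t x => f (R t x)) (F' := fun t x => fderiv ℝ f (R t x) (A (R t x)))
    (x₀ := (0 : ℝ)) (s := Set.univ) (bound := fun _ => M) Filter.univ_mem
    (Filter.Eventually.of_forall fun t =>
      ((R t).measurePreserving_sphereMeasure.integrable_comp_of_integrable
        hf.continuousOn.integrable_sphereMeasure).aestronglyMeasurable)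
    ((R 0).measurePreserving_sphereMeasure.integrable_comp_of_integrable
        hf.continuousOn.integrable_sphereMeasure)
    ((R 0).measurePreserving_sphereMeasure.integrable_comp_of_integrable
        hcont.integrable_sphereMeasure).aestronglyMeasurable
    (ae_mem_sphere.mono fun x hx t _ => hM _ (hRmem t x hx))
    (integrable_const M)
    (ae_mem_sphere.mono fun x hx t _ => by
      have hne : R t x ∈ ({0} : Set E3)ᶜ := Metric.ne_of_mem_sphere (hRmem t x hx) one_ne_zero
      have hd := (hf.contDiffAt (isOpen_compl_singleton.mem_nhds hne)).differentiableAt (by simp)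
      exact hd.hasFDerivAt.comp_hasDerivAt t (hderivR t x))
  have hconst : (fun t => ∫ x, f (R t x) ∂sphereMeasure) = fun _ => ∫ x, f x ∂sphereMeasure := by
    funext t
    exact (R t).measurePreserving_sphereMeasure.integral_comp
      (R t).toHomeomorph.measurableEmbedding f
  have h0 := key.2
  rw [hconst] at h0
  simpa [hR0] using h0.unique (hasDerivAt_const _ _)

/-- The `i`-th partial derivative. -/
def pd (i : Fin 3) (f : E3 → ℝ) : E3 → ℝ := fun x => fderiv ℝ f x (e3 i)

/-- Smoothness on the punctured space. -/
abbrev PuncturedSmooth (f : E3 → ℝ) : Prop := ContDiffOn ℝ (⊤ : ℕ∞) f {(0 : E3)}ᶜ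

namespace PuncturedSmooth

variable {f g : E3 → ℝ}

theorem contDiffAt (hf : PuncturedSmooth f) {x : E3} (hx : x ≠ 0) :
    ContDiffAt ℝ (⊤ : ℕ∞) f x :=
  ContDiffOn.contDiffAt hf (isOpen_compl_singleton.mem_nhds hx)

theorem differentiableAt (hf : PuncturedSmooth f) {x : E3} (hx : x ≠ 0) :
    DifferentiableAt ℝ f x :=
  (hf.contDiffAt hx).differentiableAt (by simp)

theorem pd (hf : PuncturedSmooth f) (i : Fin 3) : PuncturedSmooth (pd i f) :=
  (hf.fderiv_of_isOpen isOpen_compl_singleton (by simp)).clm_apply contDiffOn_const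

theorem coord (i : Fin 3) : PuncturedSmooth fun x => x i :=
  ContDiff.contDiffOn (by fun_prop)

end PuncturedSmooth

section PartialDerivatives

variable {f g : E3 → ℝ} {x : E3}

theorem pd_congr (h : ∀ y ≠ 0, f y = g y) (hx : x ≠ 0) (i : Fin 3) : pd i f x = pd i g x := by
  have h' : f =ᶠ[nhds x] g :=
    Filter.eventually_of_mem (isOpen_compl_singleton.mem_nhds hx) fun y hy => h y hy
  simp only [pd, h'.fderiv_eq]

theorem pd_const (c : ℝ) (i : Fin 3) : pd i (fun _ => c) x = 0 := by
  simp [pd]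

theorem pd_coord (i j : Fin 3) : pd i (fun y => y j) x = if i = j then 1 else 0 := by
  have h : HasFDerivAt (fun y : E3 => y j) (EuclideanSpace.proj j : E3 →L[ℝ] ℝ) x :=
    (EuclideanSpace.proj j : E3 →L[ℝ] ℝ).hasFDerivAt
  simp [pd, h.fderiv, e3, eq_comm]

theorem pd_sub (hf : PuncturedSmooth f) (hg : PuncturedSmooth g) (hx : x ≠ 0) (i : Fin 3) :
    pd i (fun y => f y - g y) x = pd i f x - pd i g x := by
  simp [pd, fderiv_fun_sub (hf.differentiableAt hx) (hg.differentiableAt hx)]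

theorem pd_mul (hf : PuncturedSmooth f) (hg : PuncturedSmooth g) (hx : x ≠ 0) (i : Fin 3) :
    pd i (fun y => f y * g y) x = pd i f x * g x + f x * pd i g x := by
  simp only [pd, fderiv_fun_mul (hf.differentiableAt hx) (hg.differentiableAt hx)]
  simp only [_root_.add_apply, _root_.smul_apply, smul_eq_mul]
  ring

theorem pd_sum {F : Fin 3 → E3 → ℝ} (hF : ∀ j, PuncturedSmooth (F j)) (hx : x ≠ 0) (i : Fin 3) :
    pd i (fun y => ∑ j, F j y) x = ∑ j, pd i (F j) x := by
  simp [pd, fderiv_fun_sum fun j _ => (hF j).differentiableAt hx]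

theorem pd_pd_eq (hf : PuncturedSmooth f) (hx : x ≠ 0) (i j : Fin 3) :
    pd i (pd j f) x = fderiv ℝ (fderiv ℝ f) x (e3 i) (e3 j) := by
  have h : DifferentiableAt ℝ (fderiv ℝ f) x :=
    ((hf.contDiffAt hx).fderiv_right (m := (⊤ : ℕ∞)) (by simp)).differentiableAt (by simp)
  have h2 := (h.hasFDerivAt.clm_apply (hasFDerivAt_const (e3 j) x)).fderiv
  change fderiv ℝ (fun y => fderiv ℝ f y (e3 j)) x (e3 i) = _
  rw [h2]
  simp

theorem pd_comm (hf : PuncturedSmooth f) (hx : x ≠ 0) (i j : Fin 3) :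
    pd i (pd j f) x = pd j (pd i f) x := by
  rw [pd_pd_eq hf hx, pd_pd_eq hf hx]
  exact ((hf.contDiffAt hx).isSymmSndFDerivAt
    (by simpa using WithTop.coe_le_coe.mpr (le_top : (2 : ℕ∞) ≤ ⊤))) (e3 i) (e3 j)

theorem hess3_eq_pd (hf : PuncturedSmooth f) (hx : x ≠ 0) (i j : Fin 3) :
    hess3 f x i j = pd i (pd j f) x := by
  simp [hess3, iteratedFDeriv_two_apply, pd_pd_eq hf hx]

theorem lap3_eq_pd (hf : PuncturedSmooth f) (hx : x ≠ 0) :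
    lap3 f x = ∑ i, pd i (pd i f) x := by
  simp only [lap3, hess3_eq_pd hf hx]

theorem PuncturedSmooth.lap3 (hf : PuncturedSmooth f) : PuncturedSmooth (lap3 f) :=
  (ContDiffOn.sum fun i _ => (hf.pd i).pd i).congr fun _ hx => lap3_eq_pd hf hx

/-- The Laplacian commutes with partial derivatives. -/
theorem pd_lap3 (hf : PuncturedSmooth f) (hx : x ≠ 0) (j : Fin 3) :
    pd j (lap3 f) x = ∑ i, pd i (pd i (pd j f)) x := by
  rw [pd_congr (fun y hy => lap3_eq_pd hf hy) hx, pd_sum (fun i => (hf.pd i).pd i) hx]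
  refine Finset.sum_congr rfl fun i _ => ?_
  rw [pd_comm (hf.pd i) hx]
  exact pd_congr (fun y hy => pd_comm hf hy j i) hx i

end PartialDerivatives

/-- Euler's equation `x · ∇f = k f` for functions homogeneous of degree `k`. -/
def EulerEq (k : ℝ) (f : E3 → ℝ) : Prop := ∀ x : E3, x ≠ 0 → ∑ j, x j * pd j f x = k * f x

namespace EulerEq

variable {f g : E3 → ℝ} {k l : ℝ}

theorem sub (hf : EulerEq k f) (hg : EulerEq k g) (sf : PuncturedSmooth f)
    (sg : PuncturedSmooth g) : EulerEq k fun x => f x - g x := by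
  intro x hx
  simp only [pd_sub sf sg hx, mul_sub, Finset.sum_sub_distrib, hf x hx, hg x hx]

theorem mul (hf : EulerEq k f) (hg : EulerEq l g) (sf : PuncturedSmooth f)
    (sg : PuncturedSmooth g) : EulerEq (k + l) fun x => f x * g x := by
  intro x hx
  have h : ∀ j, x j * pd j (fun y => f y * g y) x =
      g x * (x j * pd j f x) + f x * (x j * pd j g x) := by
    intro j
    rw [pd_mul sf sg hx]
    ring
  simp only [h, Finset.sum_add_distrib, ← Finset.mul_sum, hf x hx, hg x hx]
  ring

theorem const (c : ℝ) : EulerEq 0 fun _ => c := by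
  intro x _
  simp [pd_const]

theorem sum {F : Fin 3 → E3 → ℝ} (hF : ∀ i, EulerEq k (F i)) (sF : ∀ i, PuncturedSmooth (F i)) :
    EulerEq k fun x => ∑ i, F i x := by
  intro x hx
  simp only [pd_sum sF hx, Finset.mul_sum]
  rw [Finset.sum_comm]
  exact Finset.sum_congr rfl fun i _ => hF i x hx

theorem congr (hf : EulerEq k f) (h : ∀ y ≠ 0, g y = f y) : EulerEq k g := by
  intro x hx
  simp only [pd_congr h hx, h x hx, hf x hx]

theorem pd (hf : EulerEq k f) (sf : PuncturedSmooth f) (i : Fin 3) : EulerEq (k - 1) (pd i f) := by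
  intro x hx
  have h := pd_congr hf hx i
  rw [pd_sum (fun j => (PuncturedSmooth.coord j).mul (sf.pd j)) hx,
    pd_mul contDiffOn_const sf hx] at h
  simp only [pd_mul (PuncturedSmooth.coord _) (sf.pd _) hx, pd_coord, pd_const,
    Finset.sum_add_distrib, pd_comm sf hx i, ite_mul, one_mul, zero_mul, zero_add,
    Finset.sum_ite_eq, Finset.mem_univ, if_true] at h
  linarith

theorem lap3 (hf : EulerEq k f) (sf : PuncturedSmooth f) : EulerEq (k - 2) (lap3 f) := by
  refine (sum (fun i => (hf.pd sf i).pd (sf.pd i) i) fun i => (sf.pd i).pd i).congr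
    (fun y hy => lap3_eq_pd sf hy) |> fun h => ?_
  convert h using 1
  ring

end EulerEq

theorem Homog0.eulerEq {u : E3 → ℝ} (hu0 : Homog0 u) (hu : PuncturedSmooth u) : EulerEq 0 u := by
  intro x hx
  have hd : HasDerivAt (fun c : ℝ => u (c • x)) (fderiv ℝ u x x) 1 := by
    have h1 : HasDerivAt (fun c : ℝ => c • x) x 1 := by
      simpa using (hasDerivAt_id (1 : ℝ)).smul_const x
    have h2 : HasFDerivAt u (fderiv ℝ u x) ((1 : ℝ) • x) := by
      simpa using (hu.differentiableAt hx).hasFDerivAt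
    exact h2.comp_hasDerivAt 1 h1
  have hc : HasDerivAt (fun c : ℝ => u (c • x)) 0 1 :=
    (hasDerivAt_const (1 : ℝ) (u x)).congr_of_eventuallyEq <|
      Filter.eventually_of_mem (Ioi_mem_nhds one_pos) fun c hc => hu0 c hc x hx
  have hsum : x = ∑ j, x j • e3 j := by
    ext i
    simp [e3, Pi.single_apply]
  calc ∑ j, x j * pd j u x = fderiv ℝ u x (∑ j, x j • e3 j) := by simp [pd]
    _ = 0 * u x := by rw [← hsum, hd.unique hc, zero_mul]

/-- The rotation field `x ↦ x a • e b - x b • e a`. -/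
def rotField (a b : Fin 3) : E3 →L[ℝ] E3 :=
  (EuclideanSpace.proj a : E3 →L[ℝ] ℝ).smulRight (e3 b) -
    (EuclideanSpace.proj b : E3 →L[ℝ] ℝ).smulRight (e3 a)

theorem rotField_mem_skewAdjoint (a b : Fin 3) : rotField a b ∈ skewAdjoint (E3 →L[ℝ] E3) := by
  rw [skewAdjoint.mem_iff, ContinuousLinearMap.star_eq_adjoint, eq_comm,
    ContinuousLinearMap.eq_adjoint_iff]
  intro x y
  simp [rotField, e3, inner_sub_left, inner_sub_right, inner_smul_left, inner_smul_right,
    EuclideanSpace.inner_single_left, EuclideanSpace.inner_single_right]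
  ring

theorem integral_rotation {f : E3 → ℝ} (hf : PuncturedSmooth f) (a b : Fin 3) :
    ∫ x, (x a * pd b f x - x b * pd a f x) ∂sphereMeasure = 0 := by
  rw [← integral_fderiv_skewAdjoint hf (rotField_mem_skewAdjoint a b)]
  simp [rotField, pd]

theorem norm_sq_coord {x : E3} (hx : x ∈ Metric.sphere (0 : E3) 1) : ∑ j, x j * x j = 1 := by
  have h := EuclideanSpace.real_norm_sq_eq x
  rw [mem_sphere_zero_iff_norm.mp hx] at h
  simpa [pow_two] using h.symm

/-- Divergence theorem on the unit sphere for vector fields whose components are homogeneous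
of degree `k`. -/
theorem integral_div_sub {W : Fin 3 → E3 → ℝ} {k : ℝ} (sW : ∀ i, PuncturedSmooth (W i))
    (hW : ∀ i, EulerEq k (W i)) :
    ∫ x, ∑ i, (pd i (W i) x - (2 + k) * (x i * W i x)) ∂sphereMeasure = 0 := by
  have hpt : ∀ x ∈ Metric.sphere (0 : E3) 1,
      ∑ i, (pd i (W i) x - (2 + k) * (x i * W i x)) =
        ∑ i, ∑ j, (x j * pd i (fun y => y j * W i y) x - x i * pd j (fun y => y j * W i y) x) := by
    intro x hx
    have hx0 : x ≠ 0 := Metric.ne_of_mem_sphere hx one_ne_zero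
    refine Finset.sum_congr rfl fun i _ => ?_
    have hE := hW i x hx0
    have hn := norm_sq_coord hx
    simp only [pd_mul (PuncturedSmooth.coord _) (sW i) hx0, pd_coord]
    rw [Fin.sum_univ_three] at hE hn ⊢
    have hi : ∑ j, x j * ((if i = j then 1 else 0) * W i x) = x i * W i x := by simp
    rw [Fin.sum_univ_three] at hi
    simp only [if_true, one_mul]
    linear_combination -hi + x i * hE - pd i (W i) x * hn
  have sxW : ∀ i j, PuncturedSmooth fun y => y j * W i y := fun i j =>
    (PuncturedSmooth.coord j).mul (sW i)
  have hint : ∀ i j, Integrable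
      (fun x : E3 => x j * pd i (fun y => y j * W i y) x - x i * pd j (fun y => y j * W i y) x)
      sphereMeasure := fun i j =>
    (((PuncturedSmooth.coord j).mul ((sxW i j).pd i)).sub
      ((PuncturedSmooth.coord i).mul
        ((sxW i j).pd j))).continuousOn.integrable_sphereMeasure
  rw [integral_congr_ae (ae_mem_sphere.mono hpt),
    integral_finsetSum _ fun i _ => integrable_finsetSum _ fun j _ => hint i j]
  refine Finset.sum_eq_zero fun i _ => ?_
  rw [integral_finsetSum _ fun j _ => hint i j]
  exact Finset.sum_eq_zero fun j _ => integral_rotation (sxW i j) j i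

theorem proj3_mul_mul_proj3_apply (D : Matrix (Fin 3) (Fin 3) ℝ) (x : E3) (i j : Fin 3) :
    (proj3 x * D * proj3 x) i j = D i j - x i * ∑ k, x k * D k j - x j * ∑ k, x k * D i k +
      x i * x j * ∑ l, x l * ∑ k, x k * D k l := by
  fin_cases i <;> fin_cases j <;>
    simp [proj3, Matrix.mul_apply, Matrix.sub_apply, Matrix.one_apply, Fin.sum_univ_three] <;> ring

section SpherePointwise

variable {u : E3 → ℝ} {x : E3}

/-- The projected Hessian of a degree-0 homogeneous function is `D²u + x ∇uᵀ + ∇u xᵀ`. -/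
theorem hessS_apply (hu : PuncturedSmooth u) (hE : EulerEq 0 u) (hx : x ≠ 0) (i j : Fin 3) :
    hessS u x i j = pd i (pd j u) x + x i * pd j u x + x j * pd i u x := by
  have h0 := hE x hx
  have h1 := fun a => hE.pd hu a x hx
  simp only [hessS, proj3_mul_mul_proj3_apply, hess3_eq_pd hu hx, h1]
  simp only [pd_comm hu hx i, h1, zero_sub, neg_one_mul, mul_neg, Finset.sum_neg_distrib, h0]
  ring

/-- On the unit sphere, `|H_u|² = |D²u|² - 2 |∇u|²` for `u` homogeneous of degree 0. -/
theorem trace_hessS_sq (hu : PuncturedSmooth u) (hE : EulerEq 0 u)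
    (hx : x ∈ Metric.sphere (0 : E3) 1) :
    (hessS u x * hessS u x).trace =
      ∑ i, ∑ j, pd i (pd j u) x * pd i (pd j u) x - 2 * ∑ i, pd i u x * pd i u x := by
  have hx0 : x ≠ 0 := Metric.ne_of_mem_sphere hx one_ne_zero
  have hn := norm_sq_coord hx
  have h0 := hE x hx0
  have h1 := fun a => hE.pd hu a x hx0
  have e01 := pd_comm hu hx0 0 1
  have e02 := pd_comm hu hx0 0 2
  have e12 := pd_comm hu hx0 1 2
  simp only [Matrix.trace, Matrix.diag_apply, Matrix.mul_apply, hessS_apply hu hE hx0]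
  simp only [Fin.sum_univ_three] at h0 h1 hn ⊢
  have h10 := h1 0
  have h11 := h1 1
  have h12 := h1 2
  simp only [e01, e02, e12] at h10 h11 h12 ⊢
  linear_combination 4 * (pd 0 u x * h10 + pd 1 u x * h11 + pd 2 u x * h12) +
    2 * (pd 0 u x * pd 0 u x + pd 1 u x * pd 1 u x + pd 2 u x * pd 2 u x) * hn +
    2 * (x 0 * pd 0 u x + x 1 * pd 1 u x + x 2 * pd 2 u x) * h0

end SpherePointwise

/-- The field `2 D²u ∇u - Δu ∇u - u ∇Δu`, homogeneous of degree `-3`. -/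
def hessianField (u : E3 → ℝ) (i : Fin 3) : E3 → ℝ := fun x =>
  (∑ j, 2 * (pd i (pd j u) x * pd j u x)) - lap3 u x * pd i u x - u x * pd i (lap3 u) x

/-- The field `2 u ∇u`, homogeneous of degree `-1`. -/
def gradField (u : E3 → ℝ) (i : Fin 3) : E3 → ℝ := fun x => 2 * (u x * pd i u x)

section Fields

variable {u : E3 → ℝ} {x : E3}

theorem PuncturedSmooth.hessianField (hu : PuncturedSmooth u) (i : Fin 3) :
    PuncturedSmooth (hessianField u i) :=
  ((ContDiffOn.sum fun j _ => contDiffOn_const.mul (((hu.pd j).pd i).mul (hu.pd j))).sub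
    (hu.lap3.mul (hu.pd i))).sub (hu.mul (hu.lap3.pd i))

theorem PuncturedSmooth.gradField (hu : PuncturedSmooth u) (i : Fin 3) :
    PuncturedSmooth (gradField u i) :=
  contDiffOn_const.mul (hu.mul (hu.pd i))

theorem eulerEq_hessianField (hE : EulerEq 0 u) (hu : PuncturedSmooth u) (i : Fin 3) :
    EulerEq (-3) (hessianField u i) := by
  have s1 : ∀ j, PuncturedSmooth fun x => 2 * (pd i (pd j u) x * pd j u x) := fun j =>
    contDiffOn_const.mul (((hu.pd j).pd i).mul (hu.pd j))
  have s2 : PuncturedSmooth fun x => lap3 u x * pd i u x := hu.lap3.mul (hu.pd i)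
  have s3 : PuncturedSmooth fun x => u x * pd i (lap3 u) x := hu.mul (hu.lap3.pd i)
  have h1 : ∀ j, EulerEq (-3) fun x => 2 * (pd i (pd j u) x * pd j u x) := by
    intro j
    convert (EulerEq.const 2).mul
      (((hE.pd hu j).pd (hu.pd j) i).mul (hE.pd hu j) ((hu.pd j).pd i) (hu.pd j))
      contDiffOn_const (((hu.pd j).pd i).mul (hu.pd j)) using 1
    norm_num
  have h2 : EulerEq (-3) fun x => lap3 u x * pd i u x := by
    convert (hE.lap3 hu).mul (hE.pd hu i) hu.lap3 (hu.pd i) using 1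
    norm_num
  have h3 : EulerEq (-3) fun x => u x * pd i (lap3 u) x := by
    convert hE.mul ((hE.lap3 hu).pd hu.lap3 i) hu (hu.lap3.pd i) using 1
    norm_num
  have s12 : PuncturedSmooth fun x =>
      (∑ j, 2 * (pd i (pd j u) x * pd j u x)) - lap3 u x * pd i u x :=
    (ContDiffOn.sum fun j _ => s1 j).sub s2
  exact ((EulerEq.sum h1 s1).sub h2 (ContDiffOn.sum fun j _ => s1 j) s2).sub h3 s12 s3

theorem eulerEq_gradField (hE : EulerEq 0 u) (hu : PuncturedSmooth u) (i : Fin 3) :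
    EulerEq (-1) (gradField u i) := by
  convert (EulerEq.const 2).mul (hE.mul (hE.pd hu i) hu (hu.pd i))
    contDiffOn_const (hu.mul (hu.pd i)) using 1
  · norm_num
  · rfl

theorem pd_hessianField (hu : PuncturedSmooth u) (hx : x ≠ 0) (i : Fin 3) :
    pd i (hessianField u i) x =
      (∑ j, 2 * (pd i (pd i (pd j u)) x * pd j u x + pd i (pd j u) x * pd i (pd j u) x)) -
        (pd i (lap3 u) x * pd i u x + lap3 u x * pd i (pd i u) x) -
        (pd i u x * pd i (lap3 u) x + u x * pd i (pd i (lap3 u)) x) := by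
  have s0 : ∀ j, PuncturedSmooth fun x => pd i (pd j u) x * pd j u x := fun j =>
    ((hu.pd j).pd i).mul (hu.pd j)
  have s1 : ∀ j, PuncturedSmooth fun x => 2 * (pd i (pd j u) x * pd j u x) := fun j =>
    contDiffOn_const.mul (s0 j)
  have s2 : PuncturedSmooth fun x => lap3 u x * pd i u x := hu.lap3.mul (hu.pd i)
  have s3 : PuncturedSmooth fun x => u x * pd i (lap3 u) x := hu.mul (hu.lap3.pd i)
  have s4 : PuncturedSmooth fun x => ∑ j, 2 * (pd i (pd j u) x * pd j u x) :=
    ContDiffOn.sum fun j _ => s1 j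
  unfold hessianField
  rw [pd_sub (s4.sub s2) s3 hx, pd_sub s4 s2 hx, pd_sum s1 hx, pd_mul hu.lap3 (hu.pd i) hx,
    pd_mul hu (hu.lap3.pd i) hx]
  simp only [pd_mul contDiffOn_const (s0 _) hx, pd_const,
    pd_mul ((hu.pd _).pd i) (hu.pd _) hx, zero_mul, zero_add]

theorem pd_gradField (hu : PuncturedSmooth u) (hx : x ≠ 0) (i : Fin 3) :
    pd i (gradField u i) x = 2 * (pd i u x * pd i u x + u x * pd i (pd i u) x) := by
  unfold gradField
  rw [pd_mul contDiffOn_const (hu.mul (hu.pd i)) hx, pd_const, pd_mul hu (hu.pd i) hx]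
  ring

theorem integrand_sub_eq (hu : PuncturedSmooth u) (hE : EulerEq 0 u)
    (hx : x ∈ Metric.sphere (0 : E3) 1) :
    (2 * (hessS u x * hessS u x).trace - (lap3 u x) ^ 2) - u x * lap3 (lap3 u) x =
      ∑ i, (pd i (hessianField u i) x - (2 + -3) * (x i * hessianField u i x)) -
        ∑ i, (pd i (gradField u i) x - (2 + -1) * (x i * gradField u i x)) := by
  have hx0 : x ≠ 0 := Metric.ne_of_mem_sphere hx one_ne_zero
  have h0 := hE x hx0
  have h1 := fun a => hE.pd hu a x hx0
  have hL := hE.lap3 hu x hx0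
  have hlap := lap3_eq_pd hu hx0
  have hlap2 := lap3_eq_pd hu.lap3 hx0
  have hT := pd_lap3 hu hx0
  simp only [trace_hessS_sq hu hE hx, pd_hessianField hu hx0, pd_gradField hu hx0]
  simp only [hessianField, gradField]
  simp only [Fin.sum_univ_three] at h0 h1 hL hlap hlap2 hT ⊢
  linear_combination -(lap3 u x + 2 * u x) * hlap - u x * hlap2 + u x * hL +
    (lap3 u x - 2 * u x) * h0 + 2 * pd 0 u x * (hT 0 - h1 0) + 2 * pd 1 u x * (hT 1 - h1 1) +
    2 * pd 2 u x * (hT 2 - h1 2)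

end Fields

/-- for smooth degree-0 homogeneous u on ℝ³∖{0},
∫_{S²} [2 tr(H_u²) − (Δu)²] dS = ∫_{S²} u Δ(Δu) dS. -/
theorem integral_hessian_square (u : E3 → ℝ)
    (hu : ContDiffOn ℝ (⊤ : ℕ∞) u {(0:E3)}ᶜ) (hu0 : Homog0 u) :
    ∫ x in Metric.sphere (0:E3) 1,
        (2 * (hessS u x * hessS u x).trace - (lap3 u x) ^ 2) ∂(μH[2]) =
    ∫ x in Metric.sphere (0:E3) 1, u x * lap3 (lap3 u) x ∂(μH[2]) := by
  have hE := hu0.eulerEq hu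
  have sD := fun i => PuncturedSmooth.hessianField hu i
  have sG := fun i => PuncturedSmooth.gradField hu i
  have intU : Integrable (fun x => u x * lap3 (lap3 u) x) sphereMeasure :=
    (hu.mul (PuncturedSmooth.lap3 hu).lap3).continuousOn.integrable_sphereMeasure
  have intW : ∀ {W : Fin 3 → E3 → ℝ} (k : ℝ), (∀ i, PuncturedSmooth (W i)) →
      Integrable (fun x => ∑ i, (pd i (W i) x - (2 + k) * (x i * W i x))) sphereMeasure :=
    fun k sW => integrable_finsetSum _ fun i _ => (((sW i).pd i).sub
      (contDiffOn_const.mul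
        ((PuncturedSmooth.coord i).mul (sW i)))).continuousOn.integrable_sphereMeasure
  have key : ∀ x ∈ Metric.sphere (0 : E3) 1,
      2 * (hessS u x * hessS u x).trace - (lap3 u x) ^ 2 = u x * lap3 (lap3 u) x +
        (∑ i, (pd i (hessianField u i) x - (2 + -3) * (x i * hessianField u i x)) -
          ∑ i, (pd i (gradField u i) x - (2 + -1) * (x i * gradField u i x))) :=
    fun x hx => sub_eq_iff_eq_add'.mp (integrand_sub_eq hu hE hx)
  rw [integral_congr_ae (ae_mem_sphere.mono key)]
  refine (integral_add intU ((intW (-3) sD).sub (intW (-1) sG))).trans ?_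
  rw [integral_sub' (intW (-3) sD) (intW (-1) sG),
    integral_div_sub sD (eulerEq_hessianField hE hu), integral_div_sub sG (eulerEq_gradField hE hu)]
  simp
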